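/- arXiv:2505.18615 — 5 statements merged into one kernel-verified Lean document; each statement's English description precedes it below -/
import Mathlib

section
/- Assume in addition that ι is a join-semilattice. For i, j : ι, A ⊆ S i, B ⊆ S j, and J := i ⊔ j: the intersection of upper sets satisfies A^↑ ∩ B^↑ = F^↑, where F := r_{iJ}⁻¹(A) ∩ r_{jJ}⁻¹(B) ⊆ S J and F^↑ is taken with base-space J. Hence the conjunction of the events (A^↑, i) and (B^↑, j) is again an event, namely (A^↑ ∩ B^↑, i ⊔ j). -/
/-- The union space of the lattice model: `Ω := Σ i, S i`. For `j : ι` and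
`A ⊆ S j`, the upper set `A^↑ ⊆ Ω` consists of the states `⟨i, x⟩` with
`j ≤ i` whose projection `r _ x` to `S j` lies in `A`. -/
def upSet {ι : Type*} [PartialOrder ι] {S : ι → Type*}
    (r : ∀ ⦃j i : ι⦄, j ≤ i → S i → S j) (j : ι) (A : Set (S j)) :
    Set (Σ i, S i) :=
  {ω | ∃ h : j ≤ ω.1, r h ω.2 ∈ A}

/-- when `ι` is a join-semilattice, with `J := i ⊔ j` one has
`A^↑ ∩ B^↑ = (r_{iJ}⁻¹(A) ∩ r_{jJ}⁻¹(B))^↑` (the latter upper set taken with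
base-space `J`).  Hence the conjunction of `(A^↑, i)` and `(B^↑, j)` is again
an event, namely `(A^↑ ∩ B^↑, i ⊔ j)`. -/
theorem stmt4 {ι : Type*} [SemilatticeSup ι] {S : ι → Type*}
    (r : ∀ ⦃j i : ι⦄, j ≤ i → S i → S j)
    (hr_id : ∀ (j : ι) (x : S j), r (le_refl j) x = x)
    (hr_comp : ∀ {k j i : ι} (hkj : k ≤ j) (hji : j ≤ i) (x : S i),
      r (hkj.trans hji) x = r hkj (r hji x))
    (i j : ι) (A : Set (S i)) (B : Set (S j)) :
    upSet r i A ∩ upSet r j B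
      = upSet r (i ⊔ j)
          (r (le_sup_left : i ≤ i ⊔ j) ⁻¹' A ∩ r (le_sup_right : j ≤ i ⊔ j) ⁻¹' B) := by
  ext ⟨k, x⟩
  simp only [upSet, Set.mem_inter_iff, Set.mem_ofPred_eq, Set.mem_preimage]
  constructor
  · rintro ⟨⟨hi, hA⟩, ⟨hj, hB⟩⟩
    refine ⟨sup_le hi hj, ?_, ?_⟩
    · rwa [← hr_comp le_sup_left (sup_le hi hj)]
    · rwa [← hr_comp le_sup_right (sup_le hi hj)]
  · rintro ⟨h, hA, hB⟩
    rw [← hr_comp] at hA hB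
    exact ⟨⟨le_sup_left.trans h, hA⟩, ⟨le_sup_right.trans h, hB⟩⟩
end

section
/- Assume ι is finite. For every event e there exists a least expressive event e' ∈ 𝓔' whose base-space is ≤ the base-space of e and whose top fiber equals the top fiber of e. -/
/-- A pair `e = (A, j)` (coded as `⟨j, A⟩ : Σ j, Set (S j)`) is an event iff
`A` is nonempty, or `e` is the distinguished empty event `(∅, ⊤)`. -/
def IsEvent {ι : Type*} [PartialOrder ι] [OrderTop ι] {S : ι → Type*}
    (e : Σ j, Set (S j)) : Prop :=
  e.2.Nonempty ∨ (e.1 = ⊤ ∧ e.2 = ∅)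

/-- The top fiber of the event `(A^↑, j)`: the preimage `r_{j⊤}⁻¹(A) ⊆ S ⊤`. -/
def topFiber {ι : Type*} [PartialOrder ι] [OrderTop ι] {S : ι → Type*}
    (r : ∀ ⦃j i : ι⦄, j ≤ i → S i → S j) (e : Σ j, Set (S j)) : Set (S (⊤ : ι)) :=
  r (le_top : e.1 ≤ ⊤) ⁻¹' e.2

/-- Membership in `𝓔'`, the set of least expressive events: either the
distinguished empty event `(∅, ⊤)`, or an event `(A^↑, j)` (`A` nonempty) such
that no event `(B^↑, k)` with `k ≤ j` and `k ≠ j` has the same top fiber. -/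
def LeastExpressive {ι : Type*} [PartialOrder ι] [OrderTop ι] {S : ι → Type*}
    (r : ∀ ⦃j i : ι⦄, j ≤ i → S i → S j) (e : Σ j, Set (S j)) : Prop :=
  (e.1 = ⊤ ∧ e.2 = ∅) ∨
  (e.2.Nonempty ∧ ∀ (k : ι) (B : Set (S k)), B.Nonempty → k ≤ e.1 → k ≠ e.1 →
    topFiber r ⟨k, B⟩ ≠ topFiber r e)

/-- if `ι` is finite, then for every event `e` there is a least
expressive event `e' ∈ 𝓔'` whose base-space is `≤` the base-space of `e` and
whose top fiber equals the top fiber of `e`. -/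
theorem stmt11 {ι : Type*} [PartialOrder ι] [OrderTop ι] [Finite ι] {S : ι → Type*}
    (r : ∀ ⦃j i : ι⦄, j ≤ i → S i → S j)
    (hr_id : ∀ (j : ι) (x : S j), r (le_refl j) x = x)
    (hr_comp : ∀ {k j i : ι} (hkj : k ≤ j) (hji : j ≤ i) (x : S i),
      r (hkj.trans hji) x = r hkj (r hji x))
    (hsurj : ∀ ⦃j i : ι⦄ (h : j ≤ i), Function.Surjective (r h))
    (e : Σ j, Set (S j)) (he : IsEvent e) :
    ∃ e' : Σ j, Set (S j), LeastExpressive r e' ∧ e'.1 ≤ e.1 ∧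
      topFiber r e' = topFiber r e := by
  obtain ⟨j, A⟩ := e
  rcases he with hA | h
  · induction j using WellFoundedLT.induction with
    | ind j ih =>
      by_cases hmin : ∃ (k : ι) (B : Set (S k)), B.Nonempty ∧ k < j ∧
          topFiber r ⟨k, B⟩ = topFiber r ⟨j, A⟩
      · obtain ⟨k, B, hB, hkj, hfib⟩ := hmin
        obtain ⟨e', hleast, hle, htop⟩ := ih k hkj B hB
        exact ⟨e', hleast, hle.trans hkj.le, htop.trans hfib⟩
      · exact ⟨⟨j, A⟩, Or.inr ⟨hA, fun k B hB hle hne hfib =>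
          hmin ⟨k, B, hB, lt_of_le_of_ne hle hne, hfib⟩⟩, le_rfl, rfl⟩
  · exact ⟨⟨j, A⟩, Or.inl h, le_rfl, rfl⟩
end

section
/- Assume ι is finite. There exists a map h from the events to the least expressive events 𝓔' that preserves top fibers (the top fiber of h(e) equals the top fiber of e for every event e) and is order preserving from ≤ to ⊑: whenever e' ≤ e one has h(e') ⊑ h(e). (This is the paper's Theorem 4.) -/
/-- The order `≤` on events: `(B^↑, k) ≤ (A^↑, j)` iff `B^↑ ⊆ A^↑` and `j ≤ k`. -/
def eventLE {ι : Type*} [PartialOrder ι] {S : ι → Type*}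
    (r : ∀ ⦃j i : ι⦄, j ≤ i → S i → S j) (e' e : Σ j, Set (S j)) : Prop :=
  upSet r e'.1 e'.2 ⊆ upSet r e.1 e.2 ∧ e.1 ≤ e'.1

/-- The order `⊑` on events: inclusion of top fibers. -/
def eventSqle {ι : Type*} [PartialOrder ι] [OrderTop ι] {S : ι → Type*}
    (r : ∀ ⦃j i : ι⦄, j ≤ i → S i → S j) (e' e : Σ j, Set (S j)) : Prop :=
  topFiber r e' ⊆ topFiber r e

theorem topFiber_subset_of_eventLE {ι : Type*} [PartialOrder ι] [OrderTop ι] {S : ι → Type*}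
    (r : ∀ ⦃j i : ι⦄, j ≤ i → S i → S j) {e' e : Σ j, Set (S j)} (h : eventLE r e' e) :
    topFiber r e' ⊆ topFiber r e := fun x hx => by
  obtain ⟨_, hxe⟩ := h.1 (show (⟨⊤, x⟩ : Σ i, S i) ∈ upSet r e'.1 e'.2 from ⟨le_top, hx⟩)
  exact hxe

theorem exists_leastExpressive_of_nonempty {ι : Type*} [PartialOrder ι] [OrderTop ι]
    [WellFoundedLT ι] {S : ι → Type*} (r : ∀ ⦃j i : ι⦄, j ≤ i → S i → S j) (j : ι) :
    ∀ A : Set (S j), A.Nonempty →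
      ∃ e, LeastExpressive r e ∧ topFiber r e = topFiber r ⟨j, A⟩ := by
  induction j using WellFoundedLT.induction with
  | ind j ih =>
    intro A hA
    by_cases hmin : ∃ (k : ι) (B : Set (S k)), B.Nonempty ∧ k < j ∧
        topFiber r ⟨k, B⟩ = topFiber r ⟨j, A⟩
    · obtain ⟨k, B, hB, hkj, hBA⟩ := hmin
      obtain ⟨e, he, heB⟩ := ih k hkj B hB
      exact ⟨e, he, heB.trans hBA⟩
    · exact ⟨⟨j, A⟩, Or.inr ⟨hA, fun k B hB hkj hne hBA =>
        hmin ⟨k, B, hB, lt_of_le_of_ne hkj hne, hBA⟩⟩, rfl⟩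

theorem IsEvent.exists_leastExpressive {ι : Type*} [PartialOrder ι] [OrderTop ι]
    [WellFoundedLT ι] {S : ι → Type*} (r : ∀ ⦃j i : ι⦄, j ≤ i → S i → S j)
    {e : Σ j, Set (S j)} (he : IsEvent e) :
    ∃ e', LeastExpressive r e' ∧ topFiber r e' = topFiber r e :=
  he.elim (exists_leastExpressive_of_nonempty r e.1 e.2) fun h => ⟨e, Or.inl h, rfl⟩

/-- Theorem 4 of the paper: if `ι` is finite, there is a map
`h` from events to least expressive events preserving top fibers which is
order preserving from `≤` to `⊑`. -/
theorem stmt12 {ι : Type*} [PartialOrder ι] [OrderTop ι] [Finite ι] {S : ι → Type*}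
    (r : ∀ ⦃j i : ι⦄, j ≤ i → S i → S j)
    (hr_id : ∀ (j : ι) (x : S j), r (le_refl j) x = x)
    (hr_comp : ∀ {k j i : ι} (hkj : k ≤ j) (hji : j ≤ i) (x : S i),
      r (hkj.trans hji) x = r hkj (r hji x))
    (hsurj : ∀ ⦃j i : ι⦄ (h : j ≤ i), Function.Surjective (r h)) :
    ∃ h : (Σ j, Set (S j)) → (Σ j, Set (S j)),
      (∀ e, IsEvent e → LeastExpressive r (h e) ∧ topFiber r (h e) = topFiber r e) ∧
      (∀ e e', IsEvent e → IsEvent e' → eventLE r e' e → eventSqle r (h e') (h e)) := by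
  choose! h hmem hfib using fun (e : Σ j, Set (S j)) (he : IsEvent e) =>
    he.exists_leastExpressive r
  refine ⟨h, fun e he => ⟨hmem e he, hfib e he⟩, fun e e' he he' hle => ?_⟩
  rw [eventSqle, hfib e he, hfib e' he']
  exact topFiber_subset_of_eventLE r hle
end

section
/- Assume ι is a finite linear order with greatest element ⊤, each S i is a nonempty finite type, every projection r_{ji} is surjective, and cardinalities strictly increase with expressiveness: j < i implies card (S j) < card (S i). Then every index j : ι is the base-space of at least one least expressive event: there exists a nonempty A ⊆ S j such that the event (A^↑, j) belongs to 𝓔'. (This is the paper's Theorem 6.) -/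
/-- Theorem 6 of the paper: if `ι` is a finite linear order
with greatest element `⊤`, all state-spaces are nonempty finite types, all
projections are surjective, and strictly more expressive state-spaces have
strictly larger cardinality, then every index `j` is the base-space of at
least one least expressive event. -/
theorem stmt14 {ι : Type*} [LinearOrder ι] [Fintype ι] [OrderTop ι] {S : ι → Type*}
    [∀ i, Fintype (S i)] [∀ i, Nonempty (S i)]
    (r : ∀ ⦃j i : ι⦄, j ≤ i → S i → S j)
    (hr_id : ∀ (j : ι) (x : S j), r (le_refl j) x = x)
    (hr_comp : ∀ {k j i : ι} (hkj : k ≤ j) (hji : j ≤ i) (x : S i),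
      r (hkj.trans hji) x = r hkj (r hji x))
    (hsurj : ∀ ⦃j i : ι⦄ (h : j ≤ i), Function.Surjective (r h))
    (hcard : ∀ {j i : ι}, j < i → Fintype.card (S j) < Fintype.card (S i))
    (j : ι) :
    ∃ A : Set (S j), A.Nonempty ∧ LeastExpressive r ⟨j, A⟩ := by
  rcases (Set.Iio j).eq_empty_or_nonempty with hmin | hne
  · refine ⟨Set.univ, Set.univ_nonempty, Or.inr ⟨Set.univ_nonempty, ?_⟩⟩
    intro k _ _ hkj hkne
    exact (Set.eq_empty_iff_forall_notMem.mp hmin k (lt_of_le_of_ne hkj hkne)).elim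
  · obtain ⟨p, hpj, hmax⟩ := Set.exists_max_image (Set.Iio j) id (Set.toFinite _) hne
    replace hpj : p < j := hpj
    obtain ⟨x, y, hxy_ne, hxy⟩ :=
      Fintype.exists_ne_map_eq_of_card_lt (r hpj.le) (hcard hpj)
    refine ⟨{x}, Set.singleton_nonempty x, Or.inr ⟨Set.singleton_nonempty x, ?_⟩⟩
    intro k B _ hkj hkne heq
    have hkp : k ≤ p := hmax k (lt_of_le_of_ne hkj hkne)
    obtain ⟨x', hx'⟩ := hsurj (le_top : j ≤ ⊤) x
    obtain ⟨y', hy'⟩ := hsurj (le_top : j ≤ ⊤) y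
    have hproj : r (le_top : k ≤ ⊤) x' = r le_top y' := by
      rw [hr_comp hkj le_top x', hr_comp hkj le_top y', hx', hy',
        hr_comp hkp hpj.le x, hr_comp hkp hpj.le y, hxy]
    have hx : x' ∈ topFiber r ⟨k, B⟩ := by
      rw [heq]
      exact hx'
    have hy : y' ∈ topFiber r ⟨k, B⟩ := by
      change r (le_top : k ≤ ⊤) y' ∈ B
      rw [← hproj]
      exact hx
    rw [heq] at hy
    exact hxy_ne (hy'.symm.trans hy).symm
end

section
/- Assume ι is finite, and assume that distinct least expressive events have distinct top fibers (i.e., if e, e' ∈ 𝓔' and the top fiber of e equals the top fiber of e', then e = e'). Then the top-fiber map is an order isomorphism from (𝓔', ⊑) onto the powerset (Set (S ⊤), ⊆): it is a bijection from 𝓔' onto the subsets of S ⊤, and for all e, e' ∈ 𝓔', e' ⊑ e if and only if the top fiber of e' is contained in the top fiber of e. (This is the paper's Theorem 3.) -/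
/-- Every subset of the top space is the top fiber of a least expressive event. -/
theorem exists_leastExpressive_topFiber_eq {ι : Type*} [PartialOrder ι] [OrderTop ι] [Finite ι]
    {S : ι → Type*} (r : ∀ ⦃j i : ι⦄, j ≤ i → S i → S j)
    (hr_id : ∀ x : S ⊤, r (le_refl ⊤) x = x) (A : Set (S (⊤ : ι))) :
    ∃ e, LeastExpressive r e ∧ topFiber r e = A := by
  have htop : topFiber r ⟨⊤, A⟩ = A := by
    ext x
    change r (le_refl ⊤) x ∈ A ↔ x ∈ A
    rw [hr_id]
  rcases A.eq_empty_or_nonempty with hA | hA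
  · exact ⟨⟨⊤, A⟩, Or.inl ⟨rfl, hA⟩, htop⟩
  · obtain ⟨j, hj⟩ := (Set.toFinite
      {j : ι | ∃ B : Set (S j), B.Nonempty ∧ topFiber r ⟨j, B⟩ = A}).exists_minimal
        ⟨⊤, A, hA, htop⟩
    obtain ⟨B, hB, hBA⟩ := hj.prop
    refine ⟨⟨j, B⟩, Or.inr ⟨hB, fun k C hC hkj hne h => hne ?_⟩, hBA⟩
    exact le_antisymm hkj (hj.le_of_le ⟨C, hC, h.trans hBA⟩ hkj)

/-- Theorem 3 of the paper: if `ι` is finite and distinct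
least expressive events have distinct top fibers, then the top-fiber map is
an order isomorphism from `(𝓔', ⊑)` onto the powerset `(Set (S ⊤), ⊆)`: it is
a bijection from `𝓔'` onto the subsets of `S ⊤`, and for `e, e' ∈ 𝓔'`,
`e' ⊑ e` iff the top fiber of `e'` is contained in the top fiber of `e`. -/
theorem stmt15 {ι : Type*} [PartialOrder ι] [OrderTop ι] [Finite ι] {S : ι → Type*}
    (r : ∀ ⦃j i : ι⦄, j ≤ i → S i → S j)
    (hr_id : ∀ (j : ι) (x : S j), r (le_refl j) x = x)
    (hr_comp : ∀ {k j i : ι} (hkj : k ≤ j) (hji : j ≤ i) (x : S i),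
      r (hkj.trans hji) x = r hkj (r hji x))
    (hsurj : ∀ ⦃j i : ι⦄ (h : j ≤ i), Function.Surjective (r h))
    (hinj : ∀ e e' : Σ j, Set (S j), LeastExpressive r e → LeastExpressive r e' →
      topFiber r e = topFiber r e' → e = e') :
    Set.BijOn (topFiber r) {e : Σ j, Set (S j) | LeastExpressive r e}
        (Set.univ : Set (Set (S (⊤ : ι)))) ∧
    (∀ e e' : Σ j, Set (S j), LeastExpressive r e → LeastExpressive r e' →
      (eventSqle r e' e ↔ topFiber r e' ⊆ topFiber r e)) := by
  refine ⟨⟨fun _ _ => Set.mem_univ _, fun e he e' he' h => hinj e e' he he' h, ?_⟩,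
    fun _ _ _ _ => Iff.rfl⟩
  exact fun A _ => exists_leastExpressive_topFiber_eq r (hr_id ⊤) A
end
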